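/- arXiv:1508.07512 — 3 statements merged into one kernel-verified Lean document; each statement's English description precedes it below -/
import Mathlib

section
/- The only point x ∈ X with all coordinates x_k > 0 (k ∈ K) at which the GRAND(aZ) fluid vector field vanishes, F(x) = 0, is x = x^{*,a}; in other words, x^{*,a} is the unique strictly positive invariant (equilibrium) point of the fluid dynamics on X. -/
open scoped BigOperators
open Filter Topology

noncomputable section

variable {I S : Type} [Fintype I] [DecidableEq I] [Fintype S]

/-- The configuration `e_i` consisting of a single type-`i` customer. -/
def econf (i : I) : I → ℕ := Pi.single i 1

/-- `K^s`: the set of nonzero configurations of server type `s`. -/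
def Kc (Kbar : S → Finset (I → ℕ)) (s : S) : Finset (I → ℕ) := (Kbar s).erase 0

/-- Monotonicity of the configuration sets. -/
def KbarMono (Kbar : S → Finset (I → ℕ)) : Prop :=
  ∀ s, ∀ k ∈ Kbar s, ∀ k' : I → ℕ, (∀ i, k' i ≤ k i) → k' ∈ Kbar s

/-- Each configuration set contains the zero configuration. -/
def KbarZero (Kbar : S → Finset (I → ℕ)) : Prop := ∀ s, (0 : I → ℕ) ∈ Kbar s

/-- Every customer type can be served by some server type. -/
def KbarServe (Kbar : S → Finset (I → ℕ)) : Prop := ∀ i : I, ∃ s, econf i ∈ Kbar s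

/-- `ℝ_+^K`: nonnegative vectors supported on the nonzero configurations. -/
def orthK (Kbar : S → Finset (I → ℕ)) : Set (S → (I → ℕ) → ℝ) :=
  {x | (∀ s k, 0 ≤ x s k) ∧ ∀ s, ∀ k, k ∉ Kc Kbar s → x s k = 0}

/-- The feasible set `X` (equality constraints). -/
def feasX (Kbar : S → Finset (I → ℕ)) (ρ : I → ℝ) : Set (S → (I → ℕ) → ℝ) :=
  {x | x ∈ orthK Kbar ∧ ∀ i, ∑ s, ∑ k ∈ Kc Kbar s, (k i : ℝ) * x s k = ρ i}

/-- The relaxed feasible set (inequality constraints). -/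
def feasXge (Kbar : S → Finset (I → ℕ)) (ρ : I → ℝ) : Set (S → (I → ℕ) → ℝ) :=
  {x | x ∈ orthK Kbar ∧ ∀ i, ρ i ≤ ∑ s, ∑ k ∈ Kc Kbar s, (k i : ℝ) * x s k}

/-- The weighted number of occupied servers. -/
def objW (Kbar : S → Finset (I → ℕ)) (γ : S → ℝ) (x : S → (I → ℕ) → ℝ) : ℝ :=
  ∑ s, ∑ k ∈ Kc Kbar s, γ s * x s k

/-- `X*`: optimal solutions of LP=. -/
def XstarSet (Kbar : S → Finset (I → ℕ)) (ρ : I → ℝ) (γ : S → ℝ) :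
    Set (S → (I → ℕ) → ℝ) :=
  {x | x ∈ feasX Kbar ρ ∧ ∀ y ∈ feasX Kbar ρ, objW Kbar γ x ≤ objW Kbar γ y}

/-- `X**`: optimal solutions of LP≤. -/
def XstarSetGe (Kbar : S → Finset (I → ℕ)) (ρ : I → ℝ) (γ : S → ℝ) :
    Set (S → (I → ℕ) → ℝ) :=
  {x | x ∈ feasXge Kbar ρ ∧ ∀ y ∈ feasXge Kbar ρ, objW Kbar γ x ≤ objW Kbar γ y}

/-- `H*`: dual optimal vectors. -/
def HstarSet (Kbar : S → Finset (I → ℕ)) (ρ : I → ℝ) (γ : S → ℝ) : Set (I → ℝ) :=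
  {η | ∃ x ∈ feasX Kbar ρ, (∀ i, 0 ≤ η i) ∧
    (∀ s, ∀ k ∈ Kc Kbar s, ∑ i, (k i : ℝ) * η i ≤ γ s) ∧
    (∀ s, ∀ k ∈ Kc Kbar s, (∑ i, (k i : ℝ) * η i) < γ s → x s k = 0)}

/-- `c_k = ∏_i k_i!`. -/
def ck (k : I → ℕ) : ℝ := ∏ i, (Nat.factorial (k i) : ℝ)

/-- The function `L^{(a)}`. -/
def Lfun (Kbar : S → Finset (I → ℕ)) (a : S → ℝ) (x : S → (I → ℕ) → ℝ) : ℝ :=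
  ∑ s, ∑ k ∈ Kc Kbar s, x s k * Real.log (x s k * ck k / (Real.exp 1 * a s))

/-- Product form (infinite-server system). -/
def prodForm (Kbar : S → Finset (I → ℕ)) (a : S → ℝ) (x : S → (I → ℕ) → ℝ)
    (ν : I → ℝ) : Prop :=
  ∀ s, ∀ k ∈ Kc Kbar s, x s k = a s / ck k * Real.exp (∑ i, (k i : ℝ) * ν i)

/-- ℓ¹ distance on the coordinates indexed by `K`. -/
def distK (Kbar : S → Finset (I → ℕ)) (x y : S → (I → ℕ) → ℝ) : ℝ :=
  ∑ s, ∑ k ∈ Kc Kbar s, |x s k - y s k|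

/-- Extended coordinate value: the zero configuration of type `s` has value `a_s`. -/
def xval (a : S → ℝ) (x : S → (I → ℕ) → ℝ) (s : S) (k : I → ℕ) : ℝ :=
  if k = 0 then a s else x s k

/-- `x_{(i)}`: amount of servers available to a type-`i` arrival (GRAND(aZ)). -/
def xavail (Kbar : S → Finset (I → ℕ)) (a : S → ℝ) (x : S → (I → ℕ) → ℝ) (i : I) : ℝ :=
  ∑ s, ((if econf i ∈ Kc Kbar s then a s else 0)
    + ∑ k ∈ (Kc Kbar s).filter (fun k => k + econf i ∈ Kbar s), x s k)

/-- Departure rate `w_{k i}`. -/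
def wrate (μ : I → ℝ) (x : S → (I → ℕ) → ℝ) (s : S) (k : I → ℕ) (i : I) : ℝ :=
  (k i : ℝ) * μ i * x s k

/-- Arrival rate `v_{k i}` (GRAND(aZ)), with `λ_i = μ_i ρ_i`. -/
def vrate (Kbar : S → Finset (I → ℕ)) (a : S → ℝ) (μ ρ : I → ℝ)
    (x : S → (I → ℕ) → ℝ) (s : S) (k : I → ℕ) (i : I) : ℝ :=
  μ i * ρ i * xval a x s (k - econf i) / xavail Kbar a x i

/-- The GRAND(aZ) fluid vector field `F_k(x)`, for `k ∈ K^s`. -/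
def Fdrift (Kbar : S → Finset (I → ℕ)) (a : S → ℝ) (μ ρ : I → ℝ)
    (x : S → (I → ℕ) → ℝ) (s : S) (k : I → ℕ) : ℝ :=
  (∑ i ∈ Finset.univ.filter (fun i : I => 1 ≤ k i ∧ k - econf i ∈ Kbar s),
    (vrate Kbar a μ ρ x s k i - wrate μ x s k i))
  - ∑ i ∈ Finset.univ.filter (fun i : I => k + econf i ∈ Kbar s),
    (vrate Kbar a μ ρ x s (k + econf i) i - wrate μ x s (k + econf i) i)

/-- The function `Ξ(x)` (GRAND(aZ)). -/
def Xi (Kbar : S → Finset (I → ℕ)) (a : S → ℝ) (μ : I → ℝ)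
    (x : S → (I → ℕ) → ℝ) : ℝ :=
  ∑ i : I, ∑ s : S,
    ∑ k ∈ (Kc Kbar s).filter (fun k => 1 ≤ k i ∧ k - econf i ∈ Kbar s),
      ∑ s' : S,
        ∑ k' ∈ (Kc Kbar s').filter (fun k' => 1 ≤ k' i ∧ k' - econf i ∈ Kbar s'),
          (Real.log ((k' i : ℝ) * xval a x s (k - econf i) * x s' k')
            - Real.log ((k i : ℝ) * x s k * xval a x s' (k' - econf i)))
          * ((k i : ℝ) * μ i * x s k * xval a x s' (k' - econf i) / xavail Kbar a x i)

open Classical in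
/-- `Ξ` extended by `−∞` to points with a vanishing coordinate, as a map into `[−∞, 0] ⊆ EReal`. -/
def XiE (Kbar : S → Finset (I → ℕ)) (a : S → ℝ) (μ : I → ℝ)
    (x : S → (I → ℕ) → ℝ) : EReal :=
  if ∀ s, ∀ k ∈ Kc Kbar s, 0 < x s k then ((Xi Kbar a μ x : ℝ) : EReal) else ⊥

/-! Finite-server (GRAND-F) objects. -/

/-- `X^□`. -/
def XBox (Kbar : S → Finset (I → ℕ)) (h : S → ℝ) : Set (S → (I → ℕ) → ℝ) :=
  {x | x ∈ orthK Kbar ∧ ∀ s, ∑ k ∈ Kc Kbar s, x s k ≤ h s}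

/-- `x_{0^s} = h_s − Σ_{k∈K^s} x_k`. -/
def x0 (Kbar : S → Finset (I → ℕ)) (h : S → ℝ) (x : S → (I → ℕ) → ℝ) (s : S) : ℝ :=
  h s - ∑ k ∈ Kc Kbar s, x s k

/-- `X^⋄ = X^□ ∩ X`. -/
def XDiamond (Kbar : S → Finset (I → ℕ)) (h : S → ℝ) (ρ : I → ℝ) :
    Set (S → (I → ℕ) → ℝ) := XBox Kbar h ∩ feasX Kbar ρ

/-- Assumption A: a feasible point with idle servers of every type. -/
def AssumptionA (Kbar : S → Finset (I → ℕ)) (h : S → ℝ) (ρ : I → ℝ) : Prop :=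
  ∃ x ∈ XDiamond Kbar h ρ, ∀ s, 0 < x0 Kbar h x s

/-- The function `L^□`. -/
def LBox (Kbar : S → Finset (I → ℕ)) (h : S → ℝ) (x : S → (I → ℕ) → ℝ) : ℝ :=
  ∑ s, (x0 Kbar h x s * Real.log (x0 Kbar h x s / Real.exp 1)
    + ∑ k ∈ Kc Kbar s, x s k * Real.log (x s k * ck k / Real.exp 1))

/-- Product form (finite-server system), including the zero configurations. -/
def prodFormBox (Kbar : S → Finset (I → ℕ)) (h : S → ℝ) (x : S → (I → ℕ) → ℝ)
    (ν : I → ℝ) (β : S → ℝ) : Prop :=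
  ∀ s, x0 Kbar h x s = Real.exp (-β s) ∧
    ∀ k ∈ Kc Kbar s, x s k = Real.exp (-β s) / ck k * Real.exp (∑ i, (k i : ℝ) * ν i)

/-- Extended coordinate value for the finite-server system. -/
def xvalBox (Kbar : S → Finset (I → ℕ)) (h : S → ℝ) (x : S → (I → ℕ) → ℝ)
    (s : S) (k : I → ℕ) : ℝ :=
  if k = 0 then x0 Kbar h x s else x s k

/-- `x_{(i)}` for the finite-server system (zero configurations included). -/
def xavailBox (Kbar : S → Finset (I → ℕ)) (h : S → ℝ) (x : S → (I → ℕ) → ℝ)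
    (i : I) : ℝ :=
  ∑ s, ((if econf i ∈ Kc Kbar s then x0 Kbar h x s else 0)
    + ∑ k ∈ (Kc Kbar s).filter (fun k => k + econf i ∈ Kbar s), x s k)

/-- Arrival rate `v_{k i}` (GRAND-F), with `λ_i = μ_i ρ_i`. -/
def vrateBox (Kbar : S → Finset (I → ℕ)) (h : S → ℝ) (μ ρ : I → ℝ)
    (x : S → (I → ℕ) → ℝ) (s : S) (k : I → ℕ) (i : I) : ℝ :=
  μ i * ρ i * xvalBox Kbar h x s (k - econf i) / xavailBox Kbar h x i

/-- The GRAND-F fluid vector field `F^□_k(x)`, for `k ∈ K^s`. -/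
def FdriftBox (Kbar : S → Finset (I → ℕ)) (h : S → ℝ) (μ ρ : I → ℝ)
    (x : S → (I → ℕ) → ℝ) (s : S) (k : I → ℕ) : ℝ :=
  (∑ i ∈ Finset.univ.filter (fun i : I => 1 ≤ k i ∧ k - econf i ∈ Kbar s),
    (vrateBox Kbar h μ ρ x s k i - wrate μ x s k i))
  - ∑ i ∈ Finset.univ.filter (fun i : I => k + econf i ∈ Kbar s),
    (vrateBox Kbar h μ ρ x s (k + econf i) i - wrate μ x s (k + econf i) i)

/-- The function `Ξ^□(x̄)`. -/
def XiBox (Kbar : S → Finset (I → ℕ)) (h : S → ℝ) (μ : I → ℝ)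
    (x : S → (I → ℕ) → ℝ) : ℝ :=
  ∑ i : I, ∑ s : S,
    ∑ k ∈ (Kc Kbar s).filter (fun k => 1 ≤ k i ∧ k - econf i ∈ Kbar s),
      ∑ s' : S,
        ∑ k' ∈ (Kc Kbar s').filter (fun k' => 1 ≤ k' i ∧ k' - econf i ∈ Kbar s'),
          (Real.log ((k' i : ℝ) * xvalBox Kbar h x s (k - econf i) * x s' k')
            - Real.log ((k i : ℝ) * x s k * xvalBox Kbar h x s' (k' - econf i)))
          * ((k i : ℝ) * μ i * x s k * xvalBox Kbar h x s' (k' - econf i)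
              / xavailBox Kbar h x i)

set_option linter.unusedSectionVars false

lemma econf_ne_zero (i : I) : econf i ≠ 0 := by
  simp [econf]

lemma sub_add_econf {k : I → ℕ} {i : I} (hk : 1 ≤ k i) : k - econf i + econf i = k := by
  apply tsub_add_cancel_of_le
  intro j
  by_cases h : j = i
  · subst h; simpa [econf] using hk
  · simp [econf, h]

lemma sub_econf_mem {Kbar : S → Finset (I → ℕ)} (hmono : KbarMono Kbar) {s : S} {k : I → ℕ}
    (hk : k ∈ Kbar s) (i : I) : k - econf i ∈ Kbar s :=
  hmono s k hk _ fun _ => Nat.sub_le _ _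

/-- Reindexing a sum over configurations containing a type-`i` customer by removing it. -/
lemma sum_filter_eq_sum_add_econf {Kbar : S → Finset (I → ℕ)} (hmono : KbarMono Kbar)
    (s : S) (i : I) (f : (I → ℕ) → ℝ) :
    ∑ k ∈ (Kc Kbar s).filter (fun k => 1 ≤ k i), f k
      = ∑ k ∈ (Kbar s).filter (fun k => k + econf i ∈ Kbar s), f (k + econf i) := by
  refine Finset.sum_nbij' (fun k => k - econf i) (fun k => k + econf i) ?_ ?_ ?_ ?_ ?_
  · intro k hk
    simp only [Finset.mem_filter, Kc, Finset.mem_erase] at hk ⊢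
    rw [sub_add_econf hk.2]
    exact ⟨sub_econf_mem hmono hk.1.2 i, hk.1.2⟩
  · intro k hk
    simp only [Finset.mem_filter, Kc, Finset.mem_erase] at hk ⊢
    refine ⟨⟨fun h => ?_, hk.2⟩, by simp [econf]⟩
    simpa [econf] using congrFun h i
  · intro k hk
    exact sub_add_econf (Finset.mem_filter.1 hk).2
  · intro k _
    exact add_tsub_cancel_right k (econf i)
  · intro k hk
    simp only [sub_add_econf (Finset.mem_filter.1 hk).2]

lemma sum_Kbar_filter_eq {Kbar : S → Finset (I → ℕ)} (hzero : KbarZero Kbar)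
    (s : S) (i : I) (f : (I → ℕ) → ℝ) :
    ∑ k ∈ (Kbar s).filter (fun k => k + econf i ∈ Kbar s), f k
      = (if econf i ∈ Kc Kbar s then f 0 else 0)
        + ∑ k ∈ (Kc Kbar s).filter (fun k => k + econf i ∈ Kbar s), f k := by
  rw [Finset.sum_filter, Finset.sum_filter, ← Finset.add_sum_erase _ _ (hzero s)]
  simp [Kc, econf_ne_zero]

lemma xavail_eq_sum {Kbar : S → Finset (I → ℕ)} (hmono : KbarMono Kbar) (hzero : KbarZero Kbar)
    (a : S → ℝ) (x : S → (I → ℕ) → ℝ) (i : I) :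
    xavail Kbar a x i
      = ∑ s, ∑ k ∈ (Kc Kbar s).filter (fun k => 1 ≤ k i), xval a x s (k - econf i) := by
  refine Finset.sum_congr rfl fun s _ => ?_
  rw [sum_filter_eq_sum_add_econf hmono]
  simp only [add_tsub_cancel_right]
  rw [sum_Kbar_filter_eq hzero]
  congr 1
  · simp [xval]
  · refine Finset.sum_congr rfl fun k hk => ?_
    have : k ≠ 0 := (Finset.mem_erase.1 (Finset.mem_filter.1 hk).1).1
    simp [xval, this]

lemma xavail_pos {Kbar : S → Finset (I → ℕ)} (hserve : KbarServe Kbar)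
    {a : S → ℝ} (hapos : ∀ s, 0 < a s) {x : S → (I → ℕ) → ℝ} (hx : ∀ s k, 0 ≤ x s k) (i : I) :
    0 < xavail Kbar a x i := by
  have hsum : ∀ s, 0 ≤ ∑ k ∈ (Kc Kbar s).filter (fun k => k + econf i ∈ Kbar s), x s k :=
    fun s => Finset.sum_nonneg fun k _ => hx s k
  obtain ⟨s, hs⟩ := hserve i
  refine Finset.sum_pos' (fun s _ => add_nonneg ?_ (hsum s)) ⟨s, Finset.mem_univ s, ?_⟩
  · split_ifs
    exacts [(hapos s).le, le_rfl]
  · have hmem : econf i ∈ Kc Kbar s := Finset.mem_erase.2 ⟨econf_ne_zero i, hs⟩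
    rw [if_pos hmem]
    exact add_pos_of_pos_of_nonneg (hapos s) (hsum s)

lemma sum_coord_filter (Kbar : S → Finset (I → ℕ)) (x : S → (I → ℕ) → ℝ) (s : S) (i : I) :
    ∑ k ∈ (Kc Kbar s).filter (fun k => 1 ≤ k i), (k i : ℝ) * x s k
      = ∑ k ∈ Kc Kbar s, (k i : ℝ) * x s k := by
  rw [Finset.sum_filter]
  refine Finset.sum_congr rfl fun k _ => ?_
  split_ifs with h
  · rfl
  · simp [show k i = 0 by omega]

/-- Summation by parts for a divergence on the configuration graph. -/
lemma sum_mul_divergence {Kbar : S → Finset (I → ℕ)} (hmono : KbarMono Kbar)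
    (hzero : KbarZero Kbar) (s : S) (g : (I → ℕ) → ℝ) (hg : g 0 = 0) (n : (I → ℕ) → I → ℝ) :
    ∑ k ∈ Kc Kbar s, g k *
        ((∑ i ∈ Finset.univ.filter (fun i : I => 1 ≤ k i ∧ k - econf i ∈ Kbar s), n k i)
          - ∑ i ∈ Finset.univ.filter (fun i : I => k + econf i ∈ Kbar s), n (k + econf i) i)
      = ∑ i, ∑ k ∈ (Kc Kbar s).filter (fun k => 1 ≤ k i), (g k - g (k - econf i)) * n k i := by
  have hout : ∀ i, ∑ k ∈ (Kc Kbar s).filter (fun k => 1 ≤ k i), g (k - econf i) * n k i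
      = ∑ k ∈ (Kc Kbar s).filter (fun k => k + econf i ∈ Kbar s), g k * n (k + econf i) i := by
    intro i
    rw [sum_filter_eq_sum_add_econf hmono]
    simp only [add_tsub_cancel_right]
    rw [sum_Kbar_filter_eq hzero]
    simp [hg]
  simp only [sub_mul, Finset.sum_sub_distrib, hout]
  simp only [mul_sub, Finset.sum_sub_distrib, Finset.mul_sum, Finset.sum_filter]
  congr 1
  · rw [Finset.sum_comm]
    refine Finset.sum_congr rfl fun i _ => Finset.sum_congr rfl fun k hk => ?_
    simp [sub_econf_mem hmono (Finset.mem_erase.1 hk).2 i]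
  · rw [Finset.sum_comm]
    simp only [mul_ite, mul_zero]

lemma ck_pos (k : I → ℕ) : 0 < ck k :=
  Finset.prod_pos fun _ _ => by positivity

lemma ck_add_econf (k : I → ℕ) (i : I) : ck (k + econf i) = (k i + 1) * ck k := by
  have h : ∀ j, (((k + econf i) j).factorial : ℝ)
      = (if j = i then (k j + 1 : ℝ) else 1) * ((k j).factorial : ℝ) := by
    intro j
    by_cases hj : j = i
    · subst hj; simp [econf, Nat.factorial_succ]
    · simp [econf, hj]
  simp only [ck, h, Finset.prod_mul_distrib, Finset.prod_ite_eq', Finset.mem_univ, if_true]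

lemma ck_eq_mul {k : I → ℕ} {i : I} (hk : 1 ≤ k i) : ck k = k i * ck (k - econf i) := by
  conv_lhs => rw [← sub_add_econf hk]
  rw [ck_add_econf]
  simp [econf, Nat.cast_sub hk]

/-- The product-form weight of a configuration. -/
def pweight (a : S → ℝ) (ν : I → ℝ) (s : S) (k : I → ℕ) : ℝ :=
  a s / ck k * Real.exp (∑ i, (k i : ℝ) * ν i)

lemma pweight_zero (a : S → ℝ) (ν : I → ℝ) (s : S) : pweight a ν s 0 = a s := by
  simp [pweight, ck]

lemma pweight_pos {a : S → ℝ} (hapos : ∀ s, 0 < a s) (ν : I → ℝ) (s : S) (k : I → ℕ) :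
    0 < pweight a ν s k :=
  mul_pos (div_pos (hapos s) (ck_pos k)) (Real.exp_pos _)

lemma coord_mul_pweight (a : S → ℝ) (ν : I → ℝ) (s : S) {k : I → ℕ} {i : I} (hk : 1 ≤ k i) :
    (k i : ℝ) * pweight a ν s k = Real.exp (ν i) * pweight a ν s (k - econf i) := by
  have hexp : ∑ j, (k j : ℝ) * ν j = ν i + ∑ j, ((k - econf i) j : ℝ) * ν j := by
    conv_lhs => rw [← sub_add_econf hk]
    simp only [Pi.add_apply, Nat.cast_add, add_mul, Finset.sum_add_distrib]
    rw [add_comm]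
    congr 1
    simp [econf, Pi.single_apply]
  have hki : (k i : ℝ) ≠ 0 := by positivity
  have hc := (ck_pos (k - econf i)).ne'
  rw [pweight, pweight, ck_eq_mul hk, hexp, Real.exp_add]
  field_simp

/-- Detailed balance with activities `exp (ν i)` is the product form. -/
lemma prodForm_of_detailed_balance {Kbar : S → Finset (I → ℕ)} (hmono : KbarMono Kbar)
    {a : S → ℝ} {x : S → (I → ℕ) → ℝ} {ν : I → ℝ}
    (h : ∀ s, ∀ k ∈ Kc Kbar s, ∀ i, 1 ≤ k i →
      (k i : ℝ) * x s k = Real.exp (ν i) * xval a x s (k - econf i)) :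
    prodForm Kbar a x ν := by
  have key : ∀ n : ℕ, ∀ s, ∀ k ∈ Kbar s, ∑ i, k i = n → xval a x s k = pweight a ν s k := by
    intro n
    induction n with
    | zero =>
      intro s k _ hn
      have : k = 0 := by
        ext i
        exact (Finset.sum_eq_zero_iff.1 hn) i (Finset.mem_univ i)
      subst this
      simp [xval, pweight_zero]
    | succ n ih =>
      intro s k hk hn
      obtain ⟨i, hi⟩ : ∃ i, 1 ≤ k i := by
        by_contra! hcon
        have : ∑ i, k i = 0 := Finset.sum_eq_zero fun i _ => by have := hcon i; omega
        omega
      have hk0 : k ≠ 0 := by rintro rfl; simp at hi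
      have hsum : ∑ j, (k - econf i) j = n := by
        have h2 : ∑ j, k j = ∑ j, (k - econf i) j + 1 := by
          conv_lhs => rw [← sub_add_econf hi]
          simp only [Pi.add_apply, Finset.sum_add_distrib]
          congr 1
          simp [econf]
        omega
      have h1 := h s k (Finset.mem_erase.2 ⟨hk0, hk⟩) i hi
      rw [ih s _ (sub_econf_mem hmono hk i) hsum, ← coord_mul_pweight a ν s hi] at h1
      have hki : (k i : ℝ) ≠ 0 := by positivity
      simpa [xval, hk0] using mul_left_cancel₀ hki h1
  intro s k hk
  obtain ⟨hk0, hk⟩ := Finset.mem_erase.1 hk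
  simpa [xval, hk0, pweight] using key _ s k hk rfl

lemma mul_log_div_nonneg {p q : ℝ} (hp : 0 ≤ p) (hq : 0 < q) :
    0 ≤ p * Real.log (p / q) - p + q ∧ (p * Real.log (p / q) - p + q = 0 → p = q) := by
  rcases hp.eq_or_lt with rfl | hp
  · simp [hq.le, hq.ne']
  · have hlog : Real.log (p / q) = -Real.log (q / p) := by
      rw [← Real.log_inv, inv_div]
    have hid : p * (q / p) = q := by field_simp
    refine ⟨?_, fun h => ?_⟩
    · have := mul_le_mul_of_nonneg_left (Real.log_le_sub_one_of_pos (div_pos hq hp)) hp.le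
      rw [hlog]
      nlinarith
    · by_contra hne
      have hne' : q / p ≠ 1 := fun h1 => hne ((div_eq_one_iff_eq hp.ne').1 h1).symm
      have := mul_lt_mul_of_pos_left (Real.log_lt_sub_one_of_pos (div_pos hq hp) hne') hp
      rw [hlog] at h
      nlinarith

/-- A feasible product-form point is the unique minimizer of `L^{(a)}` on `X`. -/
lemma eq_of_prodForm_of_Lfun_le {Kbar : S → Finset (I → ℕ)} {ρ : I → ℝ} {a : S → ℝ}
    (hapos : ∀ s, 0 < a s) {x y : S → (I → ℕ) → ℝ} {ν : I → ℝ}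
    (hx : x ∈ feasX Kbar ρ) (hprod : prodForm Kbar a x ν) (hy : y ∈ feasX Kbar ρ)
    (hle : Lfun Kbar a y ≤ Lfun Kbar a x) : x = y := by
  have hpos : ∀ s, ∀ k ∈ Kc Kbar s, 0 < x s k := fun s k hk => by
    rw [hprod s k hk]
    exact pweight_pos hapos ν s k
  have hlin : ∀ z ∈ feasX Kbar ρ,
      ∑ s, ∑ k ∈ Kc Kbar s, z s k * ∑ i, (k i : ℝ) * ν i = ∑ i, ν i * ρ i := by
    intro z hz
    simp only [← hz.2, Finset.mul_sum]
    rw [Finset.sum_comm (s := Finset.univ (α := I))]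
    refine Finset.sum_congr rfl fun s _ => ?_
    rw [Finset.sum_comm]
    exact Finset.sum_congr rfl fun k _ => Finset.sum_congr rfl fun i _ => by ring
  have hlogx : ∀ s, ∀ k ∈ Kc Kbar s,
      Real.log (x s k * ck k / (Real.exp 1 * a s)) = (∑ i, (k i : ℝ) * ν i) - 1 := by
    intro s k hk
    have hc := (ck_pos k).ne'
    have ha := (hapos s).ne'
    rw [← Real.log_exp ((∑ i, (k i : ℝ) * ν i) - 1), hprod s k hk, Real.exp_sub]
    congr 1
    field_simp
  have hterm : ∀ s, ∀ k ∈ Kc Kbar s,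
      y s k * Real.log (y s k * ck k / (Real.exp 1 * a s))
        - x s k * Real.log (x s k * ck k / (Real.exp 1 * a s))
      = (y s k * Real.log (y s k / x s k) - y s k + x s k)
        + (y s k * ∑ i, (k i : ℝ) * ν i) - x s k * ∑ i, (k i : ℝ) * ν i := by
    intro s k hk
    have hxk := hpos s k hk
    rcases (hy.1.1 s k).eq_or_lt with h0 | h0
    · rw [← h0, hlogx s k hk]; ring
    · have hsplit : Real.log (y s k * ck k / (Real.exp 1 * a s))
          = Real.log (y s k / x s k) + Real.log (x s k * ck k / (Real.exp 1 * a s)) := by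
        have hc := ck_pos k
        have ha := hapos s
        rw [← Real.log_mul (by positivity) (by positivity)]
        congr 1
        field_simp
      rw [hsplit, hlogx s k hk]; ring
  have hdiff : Lfun Kbar a y - Lfun Kbar a x
      = ∑ s, ∑ k ∈ Kc Kbar s, (y s k * Real.log (y s k / x s k) - y s k + x s k) := by
    simp only [Lfun, ← Finset.sum_sub_distrib]
    rw [Finset.sum_congr rfl fun s _ => Finset.sum_congr rfl (hterm s)]
    simp only [Finset.sum_sub_distrib, Finset.sum_add_distrib]
    rw [hlin y hy, hlin x hx]
    ring
  have hnn : ∀ s, ∀ k ∈ Kc Kbar s, 0 ≤ y s k * Real.log (y s k / x s k) - y s k + x s k :=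
    fun s k hk => (mul_log_div_nonneg (hy.1.1 s k) (hpos s k hk)).1
  have hzero := le_antisymm (hdiff ▸ sub_nonpos.2 hle)
    (Finset.sum_nonneg fun s _ => Finset.sum_nonneg (hnn s))
  have h1 := (Finset.sum_eq_zero_iff_of_nonneg fun s _ => Finset.sum_nonneg (hnn s)).1 hzero
  funext s k
  by_cases hk : k ∈ Kc Kbar s
  · have h2 := (Finset.sum_eq_zero_iff_of_nonneg (hnn s)).1 (h1 s (Finset.mem_univ s)) k hk
    exact ((mul_log_div_nonneg (hy.1.1 s k) (hpos s k hk)).2 h2).symm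
  · rw [hx.1.2 s k hk, hy.1.2 s k hk]

lemma sub_log_mul_sub_nonneg {p q : ℝ} (hp : 0 < p) (hq : 0 < q) :
    0 ≤ (Real.log p - Real.log q) * (p - q) ∧
      ((Real.log p - Real.log q) * (p - q) = 0 → p = q) := by
  refine ⟨?_, fun h => ?_⟩
  · rcases le_total p q with h | h
    · exact mul_nonneg_of_nonpos_of_nonpos (sub_nonpos.2 (Real.log_le_log hp h)) (sub_nonpos.2 h)
    · exact mul_nonneg (sub_nonneg.2 (Real.log_le_log hq h)) (sub_nonneg.2 h)
  · rcases mul_eq_zero.1 h with h | h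
    · exact Real.log_injOn_pos hp hq (sub_eq_zero.1 h)
    · exact sub_eq_zero.1 h

/-- A strictly positive equilibrium is in detailed balance. -/
lemma detailed_balance_of_Fdrift_eq_zero {Kbar : S → Finset (I → ℕ)} (hmono : KbarMono Kbar)
    (hzero : KbarZero Kbar) (hserve : KbarServe Kbar) {ρ : I → ℝ} (hρpos : ∀ i, 0 < ρ i)
    {a : S → ℝ} (hapos : ∀ s, 0 < a s) {μ : I → ℝ} (hμpos : ∀ i, 0 < μ i)
    {x : S → (I → ℕ) → ℝ} (hx : x ∈ feasX Kbar ρ) (hpos : ∀ s, ∀ k ∈ Kc Kbar s, 0 < x s k)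
    (hF : ∀ s, ∀ k ∈ Kc Kbar s, Fdrift Kbar a μ ρ x s k = 0) :
    ∀ s, ∀ k ∈ Kc Kbar s, ∀ i, 1 ≤ k i →
      (k i : ℝ) * x s k = ρ i / xavail Kbar a x i * xval a x s (k - econf i) := by
  have hA := xavail_pos hserve hapos hx.1.1
  set r : I → ℝ := fun i => ρ i / xavail Kbar a x i with hr
  have hrpos : ∀ i, 0 < r i := fun i => div_pos (hρpos i) (hA i)
  have hvpos : ∀ s, ∀ k ∈ Kbar s, 0 < xval a x s k := by
    intro s k hk
    by_cases h : k = 0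
    · simpa [xval, h] using hapos s
    · simpa [xval, h] using hpos s k (Finset.mem_erase.2 ⟨h, hk⟩)
  let n : S → (I → ℕ) → I → ℝ := fun s k i => vrate Kbar a μ ρ x s k i - wrate μ x s k i
  have hn : ∀ s k i, n s k i = -(μ i * (k i * x s k - r i * xval a x s (k - econf i))) := by
    intro s k i
    simp only [n, vrate, wrate, hr]
    ring
  have hnet : ∀ i, ∑ s, ∑ k ∈ (Kc Kbar s).filter (fun k => 1 ≤ k i), n s k i = 0 := by
    intro i
    simp only [hn, Finset.sum_neg_distrib, ← Finset.mul_sum, Finset.sum_sub_distrib,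
      sum_coord_filter]
    rw [← xavail_eq_sum hmono hzero, hx.2 i, hr]
    have := (hA i).ne'
    field_simp
    simp
  let g : S → (I → ℕ) → ℝ := fun s k => Real.log (xval a x s k * ck k / a s)
  have hg0 : ∀ s, g s 0 = 0 := by
    intro s
    simp [g, xval, ck, (hapos s).ne']
  have hgsub : ∀ s, ∀ k ∈ Kc Kbar s, ∀ i, 1 ≤ k i → g s k - g s (k - econf i) - Real.log (r i)
      = Real.log (k i * x s k) - Real.log (r i * xval a x s (k - econf i)) := by
    intro s k hk i hi
    have hk' := Finset.mem_erase.1 hk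
    have h1 := hpos s k hk
    have h2 := hvpos s _ (sub_econf_mem hmono hk'.2 i)
    have h3 := ck_pos (k - econf i)
    have h4 : (0 : ℝ) < k i := by exact_mod_cast hi
    have h5 : xval a x s k = x s k := by simp [xval, hk'.1]
    simp only [g, h5]
    rw [ck_eq_mul hi, Real.log_div (by positivity) (hapos s).ne',
      Real.log_div (by positivity) (hapos s).ne', Real.log_mul h1.ne' (by positivity),
      Real.log_mul h4.ne' h3.ne', Real.log_mul h2.ne' h3.ne', Real.log_mul h4.ne' h1.ne',
      Real.log_mul (hrpos i).ne' h2.ne']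
    ring
  have hparts : ∑ s, ∑ i, ∑ k ∈ (Kc Kbar s).filter (fun k => 1 ≤ k i),
      (g s k - g s (k - econf i)) * n s k i = 0 := by
    refine Finset.sum_eq_zero fun s _ => ?_
    rw [← sum_mul_divergence hmono hzero s (g s) (hg0 s) (n s)]
    refine Finset.sum_eq_zero fun k hk => ?_
    have := hF s k hk
    rw [Fdrift] at this
    simp only [n, this, mul_zero]
  have hlogr : ∑ s, ∑ i, ∑ k ∈ (Kc Kbar s).filter (fun k => 1 ≤ k i),
      Real.log (r i) * n s k i = 0 := by
    rw [Finset.sum_comm]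
    refine Finset.sum_eq_zero fun i _ => ?_
    simp only [← Finset.mul_sum, hnet, mul_zero]
  have hdiss : ∑ s, ∑ i, ∑ k ∈ (Kc Kbar s).filter (fun k => 1 ≤ k i),
      μ i * ((Real.log (k i * x s k) - Real.log (r i * xval a x s (k - econf i)))
        * (k i * x s k - r i * xval a x s (k - econf i))) = 0 := by
    rw [← neg_eq_zero, ← sub_eq_zero.2 (hparts.trans hlogr.symm)]
    simp only [← Finset.sum_neg_distrib, ← Finset.sum_sub_distrib]
    refine Finset.sum_congr rfl fun s _ => Finset.sum_congr rfl fun i _ =>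
      Finset.sum_congr rfl fun k hk => ?_
    obtain ⟨hk, hi⟩ := Finset.mem_filter.1 hk
    rw [← hgsub s k hk i hi, hn]
    ring
  have hterm : ∀ s i, ∀ k ∈ (Kc Kbar s).filter (fun k => 1 ≤ k i),
      0 < (k i : ℝ) * x s k ∧ 0 < r i * xval a x s (k - econf i) := by
    intro s i k hk
    obtain ⟨hk, hi⟩ := Finset.mem_filter.1 hk
    exact ⟨mul_pos (by exact_mod_cast hi) (hpos s k hk), mul_pos (hrpos i)
      (hvpos s _ (sub_econf_mem hmono (Finset.mem_erase.1 hk).2 i))⟩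
  have hnn : ∀ s i, ∀ k ∈ (Kc Kbar s).filter (fun k => 1 ≤ k i),
      0 ≤ μ i * ((Real.log (k i * x s k) - Real.log (r i * xval a x s (k - econf i)))
        * (k i * x s k - r i * xval a x s (k - econf i))) := fun s i k hk =>
    mul_nonneg (hμpos i).le (sub_log_mul_sub_nonneg (hterm s i k hk).1 (hterm s i k hk).2).1
  intro s k hk i hi
  have hk' : k ∈ (Kc Kbar s).filter (fun k => 1 ≤ k i) := Finset.mem_filter.2 ⟨hk, hi⟩
  have h1 := (Finset.sum_eq_zero_iff_of_nonneg fun s _ => Finset.sum_nonneg fun i _ =>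
    Finset.sum_nonneg (hnn s i)).1 hdiss s (Finset.mem_univ s)
  have h2 := (Finset.sum_eq_zero_iff_of_nonneg fun i _ =>
    Finset.sum_nonneg (hnn s i)).1 h1 i (Finset.mem_univ i)
  have h3 := (Finset.sum_eq_zero_iff_of_nonneg (hnn s i)).1 h2 k hk'
  exact (sub_log_mul_sub_nonneg (hterm s i k hk').1 (hterm s i k hk').2).2
    ((mul_eq_zero.1 h3).resolve_left (hμpos i).ne')

/-- Conversely, detailed balance on `X` forces every net rate to vanish. -/
lemma Fdrift_eq_zero_of_detailed_balance {Kbar : S → Finset (I → ℕ)} (hmono : KbarMono Kbar)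
    (hzero : KbarZero Kbar) (hserve : KbarServe Kbar) {ρ : I → ℝ}
    {a : S → ℝ} (hapos : ∀ s, 0 < a s) (μ : I → ℝ)
    {x : S → (I → ℕ) → ℝ} (hx : x ∈ feasX Kbar ρ) {r : I → ℝ}
    (h : ∀ s, ∀ k ∈ Kc Kbar s, ∀ i, 1 ≤ k i →
      (k i : ℝ) * x s k = r i * xval a x s (k - econf i)) :
    ∀ s, ∀ k ∈ Kc Kbar s, Fdrift Kbar a μ ρ x s k = 0 := by
  have hA := xavail_pos hserve hapos hx.1.1
  have hρ : ∀ i, ρ i = r i * xavail Kbar a x i := by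
    intro i
    rw [← hx.2 i, xavail_eq_sum hmono hzero, Finset.mul_sum]
    refine Finset.sum_congr rfl fun s _ => ?_
    rw [← sum_coord_filter, Finset.mul_sum]
    refine Finset.sum_congr rfl fun k hk => ?_
    obtain ⟨hk, hi⟩ := Finset.mem_filter.1 hk
    exact h s k hk i hi
  have hnet : ∀ s, ∀ k ∈ Kc Kbar s, ∀ i, 1 ≤ k i →
      vrate Kbar a μ ρ x s k i - wrate μ x s k i = 0 := by
    intro s k hk i hi
    have hne := (hA i).ne'
    have h1 : wrate μ x s k i = μ i * (k i * x s k) := by rw [wrate]; ring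
    rw [h1, h s k hk i hi, vrate, hρ i]
    field_simp
    simp
  intro s k hk
  rw [Fdrift, Finset.sum_eq_zero, Finset.sum_eq_zero, sub_zero]
  · intro i hi
    refine hnet s _ (Finset.mem_erase.2 ⟨fun h0 => ?_, (Finset.mem_filter.1 hi).2⟩) i
      (by simp [econf])
    simpa [econf] using congrFun h0 i
  · intro i hi
    exact hnet s k hk i (Finset.mem_filter.1 hi).2.1

lemma exists_mul_abs_sub_le_mul_exp_sub {α ρ : ℝ} (hα : 0 < α) (hρ : 0 < ρ) :
    ∃ C, ∀ t : ℝ, ρ * |t| - C ≤ α * Real.exp t - ρ * t := by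
  set u := Real.log (2 * ρ / α)
  have hu : α * Real.exp u = 2 * ρ := by
    rw [Real.exp_log (by positivity)]
    field_simp
  refine ⟨2 * ρ * |u - 1|, fun t => ?_⟩
  rcases le_total 0 t with ht | ht
  · have h1 : α * Real.exp t = 2 * ρ * Real.exp (t - u) := by
      rw [← hu, mul_assoc, ← Real.exp_add]; congr 2; ring
    have h2 := Real.add_one_le_exp (t - u)
    have h3 := le_abs_self (u - 1)
    rw [h1, abs_of_nonneg ht]
    nlinarith
  · rw [abs_of_nonpos ht]
    have := mul_nonneg hρ.le (abs_nonneg (u - 1))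
    have := mul_pos hα (Real.exp_pos t)
    linarith

/-- The dual objective, whose critical points are the multipliers of a feasible product form. -/
def dualObj (Kbar : S → Finset (I → ℕ)) (ρ : I → ℝ) (a : S → ℝ) (ν : I → ℝ) : ℝ :=
  ∑ s, ∑ k ∈ Kc Kbar s, pweight a ν s k - ∑ i, ρ i * ν i

lemma pweight_econf (a : S → ℝ) (ν : I → ℝ) (s : S) (i : I) :
    pweight a ν s (econf i) = a s * Real.exp (ν i) := by
  have h := coord_mul_pweight a ν s (k := econf i) (i := i) (by simp [econf])
  rw [tsub_self, pweight_zero] at h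
  simpa [econf, mul_comm] using h

lemma exists_sum_mul_abs_sub_le_dualObj {Kbar : S → Finset (I → ℕ)} (hserve : KbarServe Kbar)
    {ρ : I → ℝ} (hρpos : ∀ i, 0 < ρ i) {a : S → ℝ} (hapos : ∀ s, 0 < a s) :
    ∃ C, ∀ ν, ∑ i, ρ i * |ν i| - C ≤ dualObj Kbar ρ a ν := by
  choose σ hσ using hserve
  choose C hC using fun i => exists_mul_abs_sub_le_mul_exp_sub (hapos (σ i)) (hρpos i)
  refine ⟨∑ i, C i, fun ν => ?_⟩
  have hinj : Set.InjOn (fun i => (⟨σ i, econf i⟩ : (_ : S) × (I → ℕ)))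
      (Finset.univ : Finset I) := by
    intro i _ j _ hij
    simp only [Sigma.mk.injEq, heq_eq_eq] at hij
    by_contra hne
    simpa [econf, hne] using congrFun hij.2 i
  have hle : ∑ i, a (σ i) * Real.exp (ν i) ≤ ∑ s, ∑ k ∈ Kc Kbar s, pweight a ν s k := by
    classical
    rw [Finset.sum_sigma']
    calc ∑ i, a (σ i) * Real.exp (ν i)
        = ∑ p ∈ Finset.univ.image (fun i => (⟨σ i, econf i⟩ : (_ : S) × (I → ℕ))),
            pweight a ν p.1 p.2 := by
          rw [Finset.sum_image hinj]
          simp only [pweight_econf]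
      _ ≤ _ := by
          refine Finset.sum_le_sum_of_subset_of_nonneg ?_ fun p _ _ =>
            (pweight_pos hapos ν p.1 p.2).le
          intro p hp
          obtain ⟨i, _, rfl⟩ := Finset.mem_image.1 hp
          exact Finset.mem_sigma.2 ⟨Finset.mem_univ _,
            Finset.mem_erase.2 ⟨econf_ne_zero i, hσ i⟩⟩
  have hsum := Finset.sum_le_sum fun i (_ : i ∈ Finset.univ) => hC i (ν i)
  simp only [Finset.sum_sub_distrib] at hsum
  rw [dualObj]
  linarith

lemma continuous_dualObj (Kbar : S → Finset (I → ℕ)) (ρ : I → ℝ) (a : S → ℝ) :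
    Continuous (dualObj Kbar ρ a) := by
  unfold dualObj pweight
  fun_prop

lemma exists_dualObj_minimizer {Kbar : S → Finset (I → ℕ)} (hserve : KbarServe Kbar)
    {ρ : I → ℝ} (hρpos : ∀ i, 0 < ρ i) {a : S → ℝ} (hapos : ∀ s, 0 < a s) :
    ∃ ν, ∀ ν', dualObj Kbar ρ a ν ≤ dualObj Kbar ρ a ν' := by
  obtain ⟨C, hC⟩ := exists_sum_mul_abs_sub_le_dualObj hserve hρpos hapos
  set R := dualObj Kbar ρ a 0 + C
  have hR : 0 ≤ R := by
    have := hC 0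
    simp at this
    linarith
  let B : Set (I → ℝ) := Set.univ.pi fun i => Set.Icc (-(R / ρ i)) (R / ρ i)
  have hB : IsCompact B := isCompact_univ_pi fun i => isCompact_Icc
  have h0 : (0 : I → ℝ) ∈ B := fun i _ => by
    have := div_nonneg hR (hρpos i).le
    simpa using this
  obtain ⟨ν, _, hν⟩ := hB.exists_isMinOn ⟨0, h0⟩ (continuous_dualObj Kbar ρ a).continuousOn
  refine ⟨ν, fun ν' => ?_⟩
  by_cases h : ν' ∈ B
  · exact hν h
  · refine (hν h0).trans ?_
    by_contra! hlt
    refine h fun i _ => abs_le.1 ?_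
    rw [le_div_iff₀ (hρpos i), mul_comm]
    have h1 := Finset.single_le_sum (f := fun i => ρ i * |ν' i|)
      (fun i _ => mul_nonneg (hρpos i).le (abs_nonneg _)) (Finset.mem_univ i)
    have h2 := hC ν'
    linarith

/-- Existence of multipliers whose product form satisfies the load constraints. -/
lemma exists_sum_coord_mul_pweight_eq {Kbar : S → Finset (I → ℕ)} (hserve : KbarServe Kbar)
    {ρ : I → ℝ} (hρpos : ∀ i, 0 < ρ i) {a : S → ℝ} (hapos : ∀ s, 0 < a s) :
    ∃ ν : I → ℝ, ∀ i, ∑ s, ∑ k ∈ Kc Kbar s, (k i : ℝ) * pweight a ν s k = ρ i := by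
  obtain ⟨ν, hν⟩ := exists_dualObj_minimizer hserve hρpos hapos
  refine ⟨ν, fun i => ?_⟩
  have hlin : ∀ (c : I → ℝ) (t : ℝ), ∑ j, c j * (ν + Pi.single i t : I → ℝ) j
      = ∑ j, c j * ν j + c i * t := by
    intro c t
    simp [mul_add, Finset.sum_add_distrib, Pi.single_apply]
  let φ : ℝ → ℝ := fun t => dualObj Kbar ρ a (ν + Pi.single i t)
  have hφ : φ = fun t => ∑ s, ∑ k ∈ Kc Kbar s, pweight a ν s k * Real.exp (k i * t)
      - (∑ j, ρ j * ν j + ρ i * t) := by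
    funext t
    simp only [φ, dualObj, pweight, hlin, Real.exp_add, mul_assoc]
  have hlinear : ∀ c : ℝ, HasDerivAt (fun t : ℝ => c * t) c 0 := fun c => by
    simpa using (hasDerivAt_id' (0 : ℝ)).const_mul c
  have hderiv : HasDerivAt φ
      (∑ s, ∑ k ∈ Kc Kbar s, pweight a ν s k * (Real.exp (k i * 0) * k i) - ρ i) 0 := by
    rw [hφ]
    refine HasDerivAt.fun_sub ?_ ((hlinear (ρ i)).const_add _)
    refine HasDerivAt.fun_sum fun s _ => HasDerivAt.fun_sum fun k _ => ?_
    exact (hlinear (k i)).exp.const_mul _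
  have hmin : ∀ t, φ 0 ≤ φ t := fun t => by
    simp only [φ, Pi.single_zero, add_zero]
    exact hν _
  have hloc : IsLocalMin φ 0 := Filter.Eventually.of_forall hmin
  have hcrit := hloc.hasDerivAt_eq_zero hderiv
  simp only [mul_zero, Real.exp_zero, one_mul] at hcrit
  rw [← sub_eq_zero.1 hcrit]
  exact Finset.sum_congr rfl fun s _ => Finset.sum_congr rfl fun k _ => mul_comm _ _

/-- The truncation of the product-form weights to `K` is in detailed balance. -/
lemma exists_feasX_detailed_balance {Kbar : S → Finset (I → ℕ)} (hmono : KbarMono Kbar)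
    (hserve : KbarServe Kbar) {ρ : I → ℝ} (hρpos : ∀ i, 0 < ρ i)
    {a : S → ℝ} (hapos : ∀ s, 0 < a s) :
    ∃ x ∈ feasX Kbar ρ, ∃ ν : I → ℝ, ∀ s, ∀ k ∈ Kc Kbar s, ∀ i, 1 ≤ k i →
      (k i : ℝ) * x s k = Real.exp (ν i) * xval a x s (k - econf i) := by
  obtain ⟨ν, hν⟩ := exists_sum_coord_mul_pweight_eq hserve hρpos hapos
  let x : S → (I → ℕ) → ℝ := fun s k => if k ∈ Kc Kbar s then pweight a ν s k else 0
  have hx : ∀ s, ∀ k ∈ Kc Kbar s, x s k = pweight a ν s k := fun s k hk => if_pos hk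
  have hxval : ∀ s, ∀ k ∈ Kbar s, xval a x s k = pweight a ν s k := by
    intro s k hk
    by_cases h : k = 0
    · simp [xval, h, pweight_zero]
    · simp only [xval, h, if_false]
      exact hx s k (Finset.mem_erase.2 ⟨h, hk⟩)
  refine ⟨x, ⟨⟨fun s k => ?_, fun s k hk => if_neg hk⟩, fun i => ?_⟩, ν, ?_⟩
  · simp only [x]
    split_ifs
    exacts [(pweight_pos hapos ν s k).le, le_rfl]
  · rw [← hν i]
    exact Finset.sum_congr rfl fun s _ => Finset.sum_congr rfl fun k hk => by rw [hx s k hk]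
  · intro s k hk i hi
    rw [hx s k hk, hxval s _ (sub_econf_mem hmono (Finset.mem_erase.1 hk).2 i),
      coord_mul_pweight a ν s hi]

/-- `x^{*,a}` is the unique strictly positive equilibrium point of the
GRAND(aZ) fluid dynamics on `X`. -/
theorem minimizer_unique_positive_equilibrium
    (Kbar : S → Finset (I → ℕ))
    (hmono : KbarMono Kbar) (hzero : KbarZero Kbar) (hserve : KbarServe Kbar)
    (ρ : I → ℝ) (hρpos : ∀ i, 0 < ρ i) (hρsum : ∑ i, ρ i = 1)
    (a : S → ℝ) (hapos : ∀ s, 0 < a s)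
    (μ : I → ℝ) (hμpos : ∀ i, 0 < μ i)
    (xstar : S → (I → ℕ) → ℝ) (hxstar : xstar ∈ feasX Kbar ρ)
    (hmin : ∀ y ∈ feasX Kbar ρ, Lfun Kbar a xstar ≤ Lfun Kbar a y) :
    (∀ s, ∀ k ∈ Kc Kbar s, Fdrift Kbar a μ ρ xstar s k = 0) ∧
    ∀ x ∈ feasX Kbar ρ, (∀ s, ∀ k ∈ Kc Kbar s, 0 < x s k) →
      (∀ s, ∀ k ∈ Kc Kbar s, Fdrift Kbar a μ ρ x s k = 0) → x = xstar := by
  refine ⟨?_, fun x hx hpos hF => ?_⟩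
  · obtain ⟨x, hx, ν, hbal⟩ := exists_feasX_detailed_balance hmono hserve hρpos hapos
    obtain rfl := eq_of_prodForm_of_Lfun_le hapos hx (prodForm_of_detailed_balance hmono hbal)
      hxstar (hmin x hx)
    exact Fdrift_eq_zero_of_detailed_balance hmono hzero hserve hapos μ hx hbal
  · have hbal := detailed_balance_of_Fdrift_eq_zero hmono hzero hserve hρpos hapos hμpos hx hpos hF
    have hr : ∀ i, Real.exp (Real.log (ρ i / xavail Kbar a x i)) = ρ i / xavail Kbar a x i :=
      fun i => Real.exp_log (div_pos (hρpos i) (xavail_pos hserve hapos hx.1.1 i))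
    exact eq_of_prodForm_of_Lfun_le hapos hx
      (prodForm_of_detailed_balance (ν := fun i => Real.log (ρ i / xavail Kbar a x i)) hmono
        fun s k hk i hi => by rw [hr]; exact hbal s k hk i hi)
      hxstar (hmin x hx)
end
end

section
/- Under Assumption A, the function L^□ (viewed as a function of x ∈ X^⋄ via x̄) attains a unique minimum over X^⋄ at a point x^{*,□}, and all coordinates of the corresponding extended vector are strictly positive: x^{*,□}_k > 0 for all k ∈ K and x^{*,□}_{0^s} = h_s − Σ_{k∈K^s} x^{*,□}_k > 0 for all s ∈ 𝓢. -/
open scoped BigOperators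
open Filter Topology

noncomputable section

variable {I S : Type} [Fintype I] [DecidableEq I] [Fintype S]

/-- The entropy-like summand `t log (c t / e)`. -/
def entTerm (c t : ℝ) : ℝ := t * Real.log (t * c / Real.exp 1)

lemma entTerm_eq {c : ℝ} (hc : c ≠ 0) (t : ℝ) :
    entTerm c t = t * Real.log t + (Real.log c - 1) * t := by
  unfold entTerm
  rcases eq_or_ne t 0 with rfl | ht
  · simp
  · rw [Real.log_div (mul_ne_zero ht hc) (Real.exp_ne_zero 1), Real.log_mul ht hc, Real.log_exp]
    ring

lemma continuous_entTerm {c : ℝ} (hc : c ≠ 0) : Continuous (entTerm c) := by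
  rw [funext (entTerm_eq hc)]
  exact Real.continuous_mul_log.add (continuous_const.mul continuous_id)

lemma strictConvexOn_entTerm {c : ℝ} (hc : c ≠ 0) :
    StrictConvexOn ℝ (Set.Ici 0) (entTerm c) := by
  rw [funext (entTerm_eq hc)]
  exact Real.strictConvexOn_mul_log.add_convexOn
    ((LinearMap.mulLeft ℝ (Real.log c - 1)).convexOn (convex_Ici 0))

lemma entTerm_mul {c t p : ℝ} (hc : c ≠ 0) (ht : 0 < t) (hp : 0 < p) :
    entTerm c (t * p) = t * entTerm c p + t * p * Real.log t := by
  rw [entTerm_eq hc, entTerm_eq hc, Real.log_mul ht.ne' hp.ne']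
  ring

section EntropySum

variable {J : Type*} {T : Finset J} {c v w : J → ℝ}

lemma sum_entTerm_midpoint_lt (hc : ∀ j ∈ T, c j ≠ 0) (hv : ∀ j ∈ T, 0 ≤ v j)
    (hw : ∀ j ∈ T, 0 ≤ w j) (hvw : ∃ j ∈ T, v j ≠ w j) :
    ∑ j ∈ T, entTerm (c j) (1 / 2 * v j + 1 / 2 * w j) <
      1 / 2 * ∑ j ∈ T, entTerm (c j) (v j) + 1 / 2 * ∑ j ∈ T, entTerm (c j) (w j) := by
  rw [Finset.mul_sum, Finset.mul_sum, ← Finset.sum_add_distrib]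
  obtain ⟨j₀, hj₀, hne⟩ := hvw
  refine Finset.sum_lt_sum (fun j hj => ?_) ⟨j₀, hj₀, ?_⟩
  · exact (strictConvexOn_entTerm (hc j hj)).convexOn.2 (hv j hj) (hw j hj)
      (by norm_num) (by norm_num) (by norm_num)
  · exact (strictConvexOn_entTerm (hc j₀ hj₀)).2 (hv j₀ hj₀) (hw j₀ hj₀) hne
      (by norm_num) (by norm_num) (by norm_num)

/-- From a boundary point, the entropy sum strictly decreases when moving slightly towards an
interior point. -/
lemma exists_sum_entTerm_lt (hc : ∀ j ∈ T, c j ≠ 0) (hv : ∀ j ∈ T, 0 ≤ v j)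
    (hw : ∀ j ∈ T, 0 < w j) (hv0 : ∃ j ∈ T, v j = 0) :
    ∃ t : ℝ, 0 < t ∧ t < 1 ∧
      ∑ j ∈ T, entTerm (c j) ((1 - t) * v j + t * w j) < ∑ j ∈ T, entTerm (c j) (v j) := by
  classical
  obtain ⟨j₀, hj₀, hz⟩ := hv0
  have hp := hw j₀ hj₀
  have hev : ∀ᶠ t in 𝓝[>] (0 : ℝ), Real.log t <
      (∑ j ∈ T, entTerm (c j) (v j) - ∑ j ∈ T, entTerm (c j) (w j)) / w j₀ :=
    Real.tendsto_log_nhdsGT_zero.eventually_lt_atBot _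
  obtain ⟨t, hlog, ht0, ht1⟩ :=
    (hev.and (Ioo_mem_nhdsGT (zero_lt_one' ℝ))).exists
  refine ⟨t, ht0, ht1, ?_⟩
  rw [lt_div_iff₀ hp] at hlog
  have hterm : ∀ j ∈ T, entTerm (c j) ((1 - t) * v j + t * w j) ≤
      (1 - t) * entTerm (c j) (v j) + t * entTerm (c j) (w j) +
        if j = j₀ then t * w j₀ * Real.log t else 0 := by
    intro j hj
    split_ifs with h
    · subst h
      rw [hz, mul_zero, zero_add, entTerm_mul (hc j hj) ht0 hp]
      simp [entTerm]
    · rw [add_zero]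
      exact (strictConvexOn_entTerm (hc j hj)).convexOn.2 (hv j hj) (hw j hj).le
        (by linarith) ht0.le (by ring)
  have hsum := Finset.sum_le_sum hterm
  rw [Finset.sum_add_distrib, Finset.sum_add_distrib, ← Finset.mul_sum, ← Finset.mul_sum,
    Finset.sum_ite_eq' T j₀, if_pos hj₀] at hsum
  nlinarith [mul_lt_mul_of_pos_left hlog ht0]

end EntropySum

omit [DecidableEq I] in
lemma ck_ne_zero (k : I → ℕ) : ck k ≠ 0 :=
  Finset.prod_ne_zero_iff.2 fun i _ => Nat.cast_ne_zero.2 (Nat.factorial_ne_zero (k i))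

/-- The index set of all configurations, including the zero ones. -/
def confIndex (Kbar : S → Finset (I → ℕ)) : Finset (Σ _ : S, I → ℕ) :=
  Finset.univ.sigma Kbar

section Box

variable {Kbar : S → Finset (I → ℕ)} {ρ : I → ℝ} {h : S → ℝ} {x y : S → (I → ℕ) → ℝ}

omit [DecidableEq I] in
lemma LBox_eq_sum_entTerm (hzero : KbarZero Kbar) (h : S → ℝ) (x : S → (I → ℕ) → ℝ) :
    LBox Kbar h x =
      ∑ j ∈ confIndex Kbar, entTerm (ck j.2) (xvalBox Kbar h x j.1 j.2) := by
  rw [confIndex, Finset.sum_sigma]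
  refine Finset.sum_congr rfl fun s _ => ?_
  rw [← Finset.add_sum_erase _ _ (hzero s)]
  congr 1
  · simp [entTerm, xvalBox, ck]
  · refine Finset.sum_congr rfl fun k hk => ?_
    simp [entTerm, xvalBox, Finset.ne_of_mem_erase hk]

omit [DecidableEq I] [Fintype S] in
lemma x0_combo {a b : ℝ} (hab : a + b = 1) (s : S) :
    x0 Kbar h (a • x + b • y) s = a * x0 Kbar h x s + b * x0 Kbar h y s := by
  simp only [x0, Pi.add_apply, Pi.smul_apply, smul_eq_mul, Finset.sum_add_distrib,
    ← Finset.mul_sum]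
  linear_combination (-h s) * hab

omit [DecidableEq I] [Fintype S] in
lemma xvalBox_combo {a b : ℝ} (hab : a + b = 1) (s : S) (k : I → ℕ) :
    xvalBox Kbar h (a • x + b • y) s k =
      a * xvalBox Kbar h x s k + b * xvalBox Kbar h y s k := by
  unfold xvalBox
  split_ifs
  · exact x0_combo hab s
  · simp

omit [DecidableEq I] [Fintype S] in
lemma convex_orthK (Kbar : S → Finset (I → ℕ)) : Convex ℝ (orthK Kbar) := by
  rintro x ⟨hx, hx'⟩ y ⟨hy, hy'⟩ a b ha hb -
  refine ⟨fun s k => ?_, fun s k hk => ?_⟩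
  · exact add_nonneg (mul_nonneg ha (hx s k)) (mul_nonneg hb (hy s k))
  · simp [hx' s k hk, hy' s k hk]

omit [DecidableEq I] in
lemma convex_feasX (Kbar : S → Finset (I → ℕ)) (ρ : I → ℝ) : Convex ℝ (feasX Kbar ρ) := by
  rintro x ⟨hx, hx'⟩ y ⟨hy, hy'⟩ a b ha hb hab
  refine ⟨convex_orthK Kbar hx hy ha hb hab, fun i => ?_⟩
  simp only [Pi.add_apply, Pi.smul_apply, smul_eq_mul, mul_add, Finset.sum_add_distrib,
    mul_left_comm _ a, mul_left_comm _ b, ← Finset.mul_sum, hx', hy']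
  linear_combination (ρ i) * hab

omit [DecidableEq I] in
lemma mem_XDiamond : x ∈ XDiamond Kbar h ρ ↔ x ∈ feasX Kbar ρ ∧ ∀ s, 0 ≤ x0 Kbar h x s := by
  simp only [XDiamond, XBox, x0, Set.mem_inter_iff, Set.mem_ofPred_eq, sub_nonneg]
  exact ⟨fun hx => ⟨hx.2, hx.1.2⟩, fun hx => ⟨⟨hx.1.1, hx.2⟩, hx.1⟩⟩

omit [DecidableEq I] in
lemma convex_XDiamond (Kbar : S → Finset (I → ℕ)) (h : S → ℝ) (ρ : I → ℝ) :
    Convex ℝ (XDiamond Kbar h ρ) := by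
  intro x hx y hy a b ha hb hab
  rw [mem_XDiamond] at hx hy ⊢
  refine ⟨convex_feasX Kbar ρ hx.1 hy.1 ha hb hab, fun s => ?_⟩
  rw [x0_combo hab]
  exact add_nonneg (mul_nonneg ha (hx.2 s)) (mul_nonneg hb (hy.2 s))

omit [DecidableEq I] in
lemma xvalBox_nonneg (hx : x ∈ XDiamond Kbar h ρ) (s : S) (k : I → ℕ) :
    0 ≤ xvalBox Kbar h x s k := by
  rw [mem_XDiamond] at hx
  unfold xvalBox
  split_ifs
  · exact hx.2 s
  · exact hx.1.1.1 s k

omit [DecidableEq I] [Fintype S] in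
lemma continuous_x0 (Kbar : S → Finset (I → ℕ)) (h : S → ℝ) (s : S) :
    Continuous fun x : S → (I → ℕ) → ℝ => x0 Kbar h x s := by
  unfold x0
  fun_prop

omit [DecidableEq I] in
lemma continuous_LBox (hzero : KbarZero Kbar) (h : S → ℝ) : Continuous (LBox Kbar h) := by
  rw [funext (LBox_eq_sum_entTerm hzero h)]
  refine continuous_finsetSum _ fun j _ => (continuous_entTerm (ck_ne_zero j.2)).comp ?_
  unfold xvalBox
  split_ifs
  · exact continuous_x0 Kbar h j.1
  · fun_prop

omit [DecidableEq I] in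
lemma isCompact_XDiamond (Kbar : S → Finset (I → ℕ)) (h : S → ℝ) (ρ : I → ℝ) :
    IsCompact (XDiamond Kbar h ρ) := by
  have hbox : IsCompact (Set.univ.pi fun s : S =>
      Set.univ.pi fun _ : I → ℕ => Set.Icc (0 : ℝ) |h s|) :=
    isCompact_univ_pi fun s => isCompact_univ_pi fun _ => isCompact_Icc
  refine hbox.of_isClosed_subset ?_ ?_
  · simp only [XDiamond, XBox, feasX, orthK, Set.ofPred_and, Set.ofPred_forall, Set.ofPred_mem_eq]
    have horth : IsClosed ((⋂ (s : S) (k : I → ℕ), {x : S → (I → ℕ) → ℝ | 0 ≤ x s k}) ∩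
        ⋂ (s : S) (k : I → ℕ) (_ : k ∉ Kc Kbar s), {x : S → (I → ℕ) → ℝ | x s k = 0}) :=
      (isClosed_iInter fun s => isClosed_iInter fun k =>
        isClosed_le (by fun_prop) (by fun_prop)).inter
      (isClosed_iInter fun s => isClosed_iInter fun k => isClosed_iInter fun _ =>
        isClosed_eq (by fun_prop) (by fun_prop))
    exact (horth.inter (isClosed_iInter fun s => isClosed_le (by fun_prop) (by fun_prop))).inter
      (horth.inter (isClosed_iInter fun i => isClosed_eq (by fun_prop) (by fun_prop)))
  · rintro x ⟨⟨⟨hx, hx'⟩, hle⟩, -⟩ s - k -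
    refine ⟨hx s k, ?_⟩
    by_cases hk : k ∈ Kc Kbar s
    · exact (Finset.single_le_sum (fun k _ => hx s k) hk).trans ((hle s).trans (le_abs_self _))
    · rw [hx' s k hk]
      exact abs_nonneg _

/-- There is a strictly positive point satisfying the equality constraints. -/
lemma exists_pos_mem_feasX (hserve : KbarServe Kbar) (hρ : ∀ i, 0 < ρ i) :
    ∃ w ∈ feasX Kbar ρ, ∀ s, ∀ k ∈ Kc Kbar s, 0 < w s k := by
  classical
  choose σ hσ using hserve
  have hσ' : ∀ i, econf i ∈ Kc Kbar (σ i) := fun i =>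
    Finset.mem_erase.2 ⟨by simp [econf], hσ i⟩
  set d : I → ℝ := fun i => ∑ s, ∑ k ∈ Kc Kbar s, (k i : ℝ) with hd
  obtain ⟨ε, hε, hεd⟩ : ∃ ε : ℝ, 0 < ε ∧ ∀ i, ε * d i ≤ ρ i := by
    have hev : ∀ᶠ ε in 𝓝[>] (0 : ℝ), ∀ i, ε * d i ≤ ρ i := by
      refine eventually_all.2 fun i => ?_
      have ht : Tendsto (fun ε : ℝ => ε * d i) (𝓝[>] 0) (𝓝 0) := by
        have hc : Continuous fun ε : ℝ => ε * d i := by fun_prop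
        exact (hc.tendsto' 0 0 (zero_mul (d i))).mono_left nhdsWithin_le_nhds
      exact ht.eventually_le_const (hρ i)
    obtain ⟨ε, hle, hpos⟩ := (hev.and self_mem_nhdsWithin).exists
    exact ⟨ε, hpos, hle⟩
  set u : S → (I → ℕ) → ℝ := fun s k =>
    ∑ j, if σ j = s ∧ econf j = k then ρ j - ε * d j else 0 with hu
  have hu0 : ∀ s k, 0 ≤ u s k := fun s k => Finset.sum_nonneg fun j _ => by
    split_ifs
    · exact sub_nonneg.2 (hεd j)
    · exact le_rfl
  refine ⟨fun s k => if k ∈ Kc Kbar s then ε + u s k else 0, ⟨⟨fun s k => ?_, fun s k hk => ?_⟩,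
    fun i => ?_⟩, fun s k hk => ?_⟩
  · dsimp only
    split_ifs
    · exact add_nonneg hε.le (hu0 s k)
    · exact le_rfl
  · exact if_neg hk
  · have hsu : ∑ s, ∑ k ∈ Kc Kbar s, (k i : ℝ) * u s k = ρ i - ε * d i := by
      calc ∑ s, ∑ k ∈ Kc Kbar s, (k i : ℝ) * u s k
          = ∑ j, ∑ s, ∑ k ∈ Kc Kbar s,
              (k i : ℝ) * (if σ j = s ∧ econf j = k then ρ j - ε * d j else 0) := by
            simp only [hu, Finset.mul_sum]
            rw [Finset.sum_comm]
            refine Finset.sum_congr rfl fun s _ => ?_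
            rw [Finset.sum_comm]
        _ = ∑ j, (econf j i : ℝ) * (ρ j - ε * d j) := by
            refine Finset.sum_congr rfl fun j _ => ?_
            rw [Finset.sum_eq_single_of_mem (σ j) (Finset.mem_univ _),
              Finset.sum_eq_single_of_mem (econf j) (hσ' j)]
            · simp
            · intro k _ hk
              simp [hk.symm]
            · intro s _ hs
              simp [hs.symm]
        _ = ρ i - ε * d i := by
            simp [econf, Pi.single_apply]
    calc ∑ s, ∑ k ∈ Kc Kbar s, (k i : ℝ) * (if k ∈ Kc Kbar s then ε + u s k else 0)
        = ∑ s, ∑ k ∈ Kc Kbar s, (ε * (k i : ℝ) + (k i : ℝ) * u s k) := by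
          refine Finset.sum_congr rfl fun s _ => Finset.sum_congr rfl fun k hk => ?_
          rw [if_pos hk]
          ring
      _ = ρ i := by
          simp only [Finset.sum_add_distrib, hsu, ← Finset.mul_sum]
          simp [hd]
  · dsimp only
    rw [if_pos hk]
    exact add_pos_of_pos_of_nonneg hε (hu0 s k)

/-- Under Assumption A there is a feasible point all of whose extended coordinates are positive. -/
lemma exists_pos_mem_XDiamond (hserve : KbarServe Kbar) (hρ : ∀ i, 0 < ρ i)
    (hA : AssumptionA Kbar h ρ) :
    ∃ p ∈ XDiamond Kbar h ρ, (∀ s, ∀ k ∈ Kc Kbar s, 0 < p s k) ∧ ∀ s, 0 < x0 Kbar h p s := by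
  obtain ⟨x, hx, hx0⟩ := hA
  obtain ⟨w, hw, hwpos⟩ := exists_pos_mem_feasX hserve hρ
  have hev : ∀ᶠ t in 𝓝[>] (0 : ℝ), ∀ s, 0 < x0 Kbar h ((1 - t) • x + t • w) s := by
    refine eventually_all.2 fun s => ?_
    have hc : Continuous fun t : ℝ => x0 Kbar h ((1 - t) • x + t • w) s :=
      (continuous_x0 Kbar h s).comp (by fun_prop)
    have ht := (hc.tendsto' 0 (x0 Kbar h x s) (by simp)).mono_left
      (nhdsWithin_le_nhds (s := Set.Ioi 0))
    exact ht.eventually_const_lt (hx0 s)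
  obtain ⟨t, hpos, ht0, ht1⟩ := (hev.and (Ioo_mem_nhdsGT (zero_lt_one' ℝ))).exists
  refine ⟨(1 - t) • x + t • w, mem_XDiamond.2 ⟨convex_feasX Kbar ρ hx.2 hw (by linarith) ht0.le
    (by ring), fun s => (hpos s).le⟩, fun s k hk => ?_, hpos⟩
  exact add_pos_of_nonneg_of_pos (mul_nonneg (by linarith) (hx.2.1.1 s k))
    (mul_pos ht0 (hwpos s k hk))

omit [DecidableEq I] [Fintype S] in
lemma xvalBox_of_mem_Kc {s : S} {k : I → ℕ} (hk : k ∈ Kc Kbar s) :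
    xvalBox Kbar h x s k = x s k :=
  if_neg (Finset.ne_of_mem_erase hk)

omit [Fintype I] [DecidableEq I] in
lemma mem_confIndex {s : S} {k : I → ℕ} :
    (⟨s, k⟩ : Σ _ : S, I → ℕ) ∈ confIndex Kbar ↔ k ∈ Kbar s := by
  simp [confIndex]

omit [DecidableEq I] in
lemma LBox_midpoint_lt (hzero : KbarZero Kbar) (hx : x ∈ XDiamond Kbar h ρ)
    (hy : y ∈ XDiamond Kbar h ρ) (hxy : x ≠ y) :
    LBox Kbar h ((1 / 2 : ℝ) • x + (1 / 2 : ℝ) • y) <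
      1 / 2 * LBox Kbar h x + 1 / 2 * LBox Kbar h y := by
  have hab : (1 / 2 : ℝ) + 1 / 2 = 1 := by norm_num
  have hne : ∃ j ∈ confIndex Kbar, xvalBox Kbar h x j.1 j.2 ≠ xvalBox Kbar h y j.1 j.2 := by
    by_contra! hall
    refine hxy (funext fun s => funext fun k => ?_)
    by_cases hk : k ∈ Kc Kbar s
    · have hxyk := hall ⟨s, k⟩ (mem_confIndex.2 (Finset.mem_of_mem_erase hk))
      rwa [xvalBox_of_mem_Kc hk, xvalBox_of_mem_Kc hk] at hxyk
    · rw [hx.2.1.2 s k hk, hy.2.1.2 s k hk]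
  have hlt := sum_entTerm_midpoint_lt (T := confIndex Kbar) (c := fun j => ck j.2)
    (v := fun j => xvalBox Kbar h x j.1 j.2) (w := fun j => xvalBox Kbar h y j.1 j.2)
    (fun j _ => ck_ne_zero j.2) (fun j _ => xvalBox_nonneg hx j.1 j.2)
    (fun j _ => xvalBox_nonneg hy j.1 j.2) hne
  simpa only [LBox_eq_sum_entTerm hzero, xvalBox_combo hab] using hlt

lemma xvalBox_pos_of_isMinOn (hzero : KbarZero Kbar) (hserve : KbarServe Kbar)
    (hρ : ∀ i, 0 < ρ i) (hA : AssumptionA Kbar h ρ) (hx : x ∈ XDiamond Kbar h ρ)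
    (hmin : ∀ y ∈ XDiamond Kbar h ρ, LBox Kbar h x ≤ LBox Kbar h y)
    {s : S} {k : I → ℕ} (hk : k ∈ Kbar s) : 0 < xvalBox Kbar h x s k := by
  refine (xvalBox_nonneg hx s k).lt_of_ne' fun hz => ?_
  obtain ⟨p, hp, hpK, hp0⟩ := exists_pos_mem_XDiamond hserve hρ hA
  obtain ⟨t, ht0, ht1, hlt⟩ := exists_sum_entTerm_lt (T := confIndex Kbar)
    (c := fun j => ck j.2) (v := fun j => xvalBox Kbar h x j.1 j.2)
    (w := fun j => xvalBox Kbar h p j.1 j.2) (fun j _ => ck_ne_zero j.2)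
    (fun j _ => xvalBox_nonneg hx _ _)
    (fun j hj => by
      unfold xvalBox
      split_ifs with h0
      · exact hp0 j.1
      · exact hpK j.1 j.2 (Finset.mem_erase.2 ⟨h0, mem_confIndex.1 hj⟩))
    ⟨⟨s, k⟩, mem_confIndex.2 hk, hz⟩
  have hle := hmin _ (convex_XDiamond Kbar h ρ hx hp (sub_nonneg.2 ht1.le) ht0.le
    (sub_add_cancel 1 t))
  simp only [LBox_eq_sum_entTerm hzero, xvalBox_combo (sub_add_cancel 1 t)] at hle
  exact hle.not_gt hlt

end Box

/-- under Assumption A, `L^□` has a unique minimizer over `X^⋄`, and all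
extended coordinates of the minimizer are strictly positive. -/
theorem LBox_unique_minimizer_positive
    (Kbar : S → Finset (I → ℕ))
    (hmono : KbarMono Kbar) (hzero : KbarZero Kbar) (hserve : KbarServe Kbar)
    (ρ : I → ℝ) (hρpos : ∀ i, 0 < ρ i) (hρsum : ∑ i, ρ i = 1)
    (h : S → ℝ) (hhpos : ∀ s, 0 < h s)
    (hA : AssumptionA Kbar h ρ) :
    ∃ x : S → (I → ℕ) → ℝ,
      (x ∈ XDiamond Kbar h ρ ∧ ∀ y ∈ XDiamond Kbar h ρ, LBox Kbar h x ≤ LBox Kbar h y) ∧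
      (∀ x' : S → (I → ℕ) → ℝ, x' ∈ XDiamond Kbar h ρ →
        (∀ y ∈ XDiamond Kbar h ρ, LBox Kbar h x' ≤ LBox Kbar h y) → x' = x) ∧
      (∀ s, ∀ k ∈ Kc Kbar s, 0 < x s k) ∧
      (∀ s, 0 < x0 Kbar h x s) := by
  obtain ⟨x, hx, hmin⟩ := (isCompact_XDiamond Kbar h ρ).exists_isMinOn
    (hA.imp fun _ hy => hy.1) (continuous_LBox hzero h).continuousOn
  have hpos : ∀ s, ∀ k ∈ Kbar s, 0 < xvalBox Kbar h x s k := fun s k hk =>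
    xvalBox_pos_of_isMinOn hzero hserve hρpos hA hx hmin hk
  refine ⟨x, ⟨hx, hmin⟩, fun x' hx' hmin' => ?_, fun s k hk => ?_, fun s => ?_⟩
  · by_contra hne
    have hlt := LBox_midpoint_lt hzero hx' hx hne
    have hle := hmin' _ (convex_XDiamond Kbar h ρ hx' hx one_half_pos.le one_half_pos.le
      (add_halves (1 : ℝ)))
    have hge : LBox Kbar h x ≤ LBox Kbar h x' := hmin hx'
    linarith [hmin' x hx]
  · simpa [xvalBox_of_mem_Kc hk] using hpos s k (Finset.mem_of_mem_erase hk)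
  · simpa [xvalBox] using hpos s 0 (hzero s)
end
end

section
/- Under Assumption A, let (ν^{*,□}, β*) be the unique vectors for which x^{*,□} has the product form x^{*,□}_k = (e^{−β*_s}/c_k)·exp(Σ_i k_i ν^{*,□}_i), k ∈ K̄^s. Define the parameter vector a by a_s = e^{−β*_s}. Then x^{*,□} is the unique minimizer of L^{(a)}(x) = Σ_s Σ_{k∈K^s} x_k log(x_k c_k/(e·a_s)) over X, i.e. x^{*,□} = x^{*,a}, and ν^{*,□} coincides with the unique vector ν^{*,a} for which x^{*,a}_k = (a_s/c_k)·exp(Σ_i k_i ν_i^{*,a}), k ∈ K^s. -/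
open scoped BigOperators
open Filter Topology

noncomputable section

variable {I S : Type} [Fintype I] [DecidableEq I] [Fintype S]

lemma mul_log_product_value {a c : ℝ} (ha : 0 < a) (hc : 0 < c) (t : ℝ) :
    a / c * Real.exp t * Real.log (a / c * Real.exp t * c / (Real.exp 1 * a))
      = a / c * Real.exp t * t - a / c * Real.exp t := by
  have e : a / c * Real.exp t * c / (Real.exp 1 * a) = Real.exp (t - 1) := by
    rw [Real.exp_sub]; field_simp
  rw [e, Real.log_exp]; ring

lemma lt_mul_log_of_ne {a c y : ℝ} (ha : 0 < a) (hc : 0 < c) (hy : 0 ≤ y) (t : ℝ)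
    (hne : y ≠ a / c * Real.exp t) :
    y * t - a / c * Real.exp t < y * Real.log (y * c / (Real.exp 1 * a)) := by
  have hx : 0 < a / c * Real.exp t := by positivity
  rcases hy.eq_or_lt with rfl | hy
  · simpa using hx
  set x := a / c * Real.exp t with hxdef
  have hlog : Real.log (y * c / (Real.exp 1 * a)) = t - 1 - Real.log (x / y) := by
    have e : y * c / (Real.exp 1 * a) = Real.exp (t - 1) / (x / y) := by
      rw [hxdef, Real.exp_sub]; field_simp
    rw [e, Real.log_div (Real.exp_pos _).ne' (div_pos hx hy).ne', Real.log_exp]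
  have hlt := Real.log_lt_sub_one_of_pos (div_pos hx hy)
    (fun h => hne ((div_eq_one_iff_eq hy.ne').1 h).symm)
  have hmul := mul_lt_mul_of_pos_left hlt hy
  have hxy : y * (x / y - 1) = x - y := by field_simp
  rw [hlog]
  linarith

lemma le_mul_log {a c y : ℝ} (ha : 0 < a) (hc : 0 < c) (hy : 0 ≤ y) (t : ℝ) :
    y * t - a / c * Real.exp t ≤ y * Real.log (y * c / (Real.exp 1 * a)) := by
  by_cases hne : y = a / c * Real.exp t
  · rw [hne, mul_log_product_value ha hc]
  · exact (lt_mul_log_of_ne ha hc hy t hne).le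

/-- On the feasible set the linear functional with coefficients `k ↦ ∑ i, k i * ν i`
is constant. -/
lemma sum_mul_of_mem_feasX {Kbar : S → Finset (I → ℕ)} {ρ : I → ℝ}
    {y : S → (I → ℕ) → ℝ} (hy : y ∈ feasX Kbar ρ) (ν : I → ℝ) :
    ∑ s, ∑ k ∈ Kc Kbar s, y s k * ∑ i, (k i : ℝ) * ν i = ∑ i, ρ i * ν i := by
  simp_rw [← hy.2, Finset.sum_mul, Finset.mul_sum]
  rw [Finset.sum_comm]
  refine Finset.sum_congr rfl fun s _ => ?_
  rw [Finset.sum_comm]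
  exact Finset.sum_congr rfl fun i _ => Finset.sum_congr rfl fun k _ => by ring

lemma Lfun_of_prodForm {Kbar : S → Finset (I → ℕ)} {ρ : I → ℝ} {a : S → ℝ}
    (ha : ∀ s, 0 < a s) {x : S → (I → ℕ) → ℝ} {ν : I → ℝ} (hx : x ∈ feasX Kbar ρ)
    (hpf : prodForm Kbar a x ν) :
    Lfun Kbar a x = ∑ i, ρ i * ν i - ∑ s, ∑ k ∈ Kc Kbar s, x s k := by
  simp_rw [← sum_mul_of_mem_feasX hx ν, ← Finset.sum_sub_distrib]
  refine Finset.sum_congr rfl fun s _ => Finset.sum_congr rfl fun k hk => ?_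
  rw [hpf s k hk, mul_log_product_value (ha s) (ck_pos k)]

/-- A feasible point of product form minimizes `L^{(a)}` over `X`. -/
lemma Lfun_le_of_prodForm {Kbar : S → Finset (I → ℕ)} {ρ : I → ℝ} {a : S → ℝ}
    (ha : ∀ s, 0 < a s) {x y : S → (I → ℕ) → ℝ} {ν : I → ℝ} (hx : x ∈ feasX Kbar ρ)
    (hpf : prodForm Kbar a x ν) (hy : y ∈ feasX Kbar ρ) :
    Lfun Kbar a x ≤ Lfun Kbar a y := by
  rw [Lfun_of_prodForm ha hx hpf, ← sum_mul_of_mem_feasX hy ν]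
  simp_rw [← Finset.sum_sub_distrib]
  refine Finset.sum_le_sum fun s _ => Finset.sum_le_sum fun k hk => ?_
  rw [hpf s k hk]
  exact le_mul_log (ha s) (ck_pos k) (hy.1.1 s k) _

/-- A feasible point of product form is the only minimizer of `L^{(a)}` over `X`. -/
lemma eq_of_Lfun_le_of_prodForm {Kbar : S → Finset (I → ℕ)} {ρ : I → ℝ} {a : S → ℝ}
    (ha : ∀ s, 0 < a s) {x y : S → (I → ℕ) → ℝ} {ν : I → ℝ} (hx : x ∈ feasX Kbar ρ)
    (hpf : prodForm Kbar a x ν) (hy : y ∈ feasX Kbar ρ)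
    (hle : Lfun Kbar a y ≤ Lfun Kbar a x) : y = x := by
  by_contra hne
  obtain ⟨s, k, hsk⟩ : ∃ s k, y s k ≠ x s k := by
    by_contra! h
    exact hne (funext fun s => funext (h s))
  have hk : k ∈ Kc Kbar s := by
    by_contra hk
    exact hsk ((hy.1.2 s k hk).trans (hx.1.2 s k hk).symm)
  refine hle.not_gt ?_
  rw [Lfun_of_prodForm ha hx hpf, ← sum_mul_of_mem_feasX hy ν]
  simp_rw [← Finset.sum_sub_distrib]
  have hterm : ∀ s, ∀ k ∈ Kc Kbar s, y s k * ∑ i, (k i : ℝ) * ν i - x s k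
      ≤ y s k * Real.log (y s k * ck k / (Real.exp 1 * a s)) := fun s k hk => by
    rw [hpf s k hk]
    exact le_mul_log (ha s) (ck_pos k) (hy.1.1 s k) _
  refine Finset.sum_lt_sum (fun s _ => Finset.sum_le_sum (hterm s)) ⟨s, Finset.mem_univ s,
    Finset.sum_lt_sum (hterm s) ⟨k, hk, ?_⟩⟩
  rw [hpf s k hk] at hsk ⊢
  exact lt_mul_log_of_ne (ha s) (ck_pos k) (hy.1.1 s k) _ hsk

/-- The multiplier in the product form is determined by the configurations `e_i`. -/
lemma prodForm_unique {Kbar : S → Finset (I → ℕ)} (hserve : KbarServe Kbar) {a : S → ℝ}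
    (ha : ∀ s, 0 < a s) {x : S → (I → ℕ) → ℝ} {ν ν' : I → ℝ}
    (hν : prodForm Kbar a x ν) (hν' : prodForm Kbar a x ν') : ν' = ν := by
  funext i
  obtain ⟨s, hs⟩ := hserve i
  have hk : econf i ∈ Kc Kbar s :=
    Finset.mem_erase.2 ⟨fun h => by simpa [econf] using congrFun h i, hs⟩
  have hsum : ∀ w : I → ℝ, ∑ j, (econf i j : ℝ) * w j = w i := fun w => by
    simp [econf, Pi.single_apply]
  have e := (hν' s _ hk).symm.trans (hν s _ hk)
  rw [hsum, hsum] at e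
  exact Real.exp_injective (mul_left_cancel₀ (div_pos (ha s) (ck_pos _)).ne' e)

/-- with `a_s = e^{−β*_s}`, the minimizer `x^{*,□}` of `L^□` over `X^⋄` is
the unique minimizer `x^{*,a}` of `L^{(a)}` over `X`, and `ν^{*,□} = ν^{*,a}`. -/
theorem LBox_minimizer_is_Lfun_minimizer
    (Kbar : S → Finset (I → ℕ))
    (hmono : KbarMono Kbar) (hzero : KbarZero Kbar) (hserve : KbarServe Kbar)
    (ρ : I → ℝ) (hρpos : ∀ i, 0 < ρ i) (hρsum : ∑ i, ρ i = 1)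
    (h : S → ℝ) (hhpos : ∀ s, 0 < h s)
    (hA : AssumptionA Kbar h ρ)
    (xB : S → (I → ℕ) → ℝ) (hxB : xB ∈ XDiamond Kbar h ρ)
    (hminB : ∀ y ∈ XDiamond Kbar h ρ, LBox Kbar h xB ≤ LBox Kbar h y)
    (ν : I → ℝ) (β : S → ℝ) (hpf : prodFormBox Kbar h xB ν β) :
    (xB ∈ feasX Kbar ρ ∧
      ∀ y ∈ feasX Kbar ρ,
        Lfun Kbar (fun s => Real.exp (-β s)) xB ≤ Lfun Kbar (fun s => Real.exp (-β s)) y) ∧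
    (∀ x' : S → (I → ℕ) → ℝ, x' ∈ feasX Kbar ρ →
      (∀ y ∈ feasX Kbar ρ,
        Lfun Kbar (fun s => Real.exp (-β s)) x' ≤ Lfun Kbar (fun s => Real.exp (-β s)) y) →
      x' = xB) ∧
    prodForm Kbar (fun s => Real.exp (-β s)) xB ν ∧
    (∀ ν' : I → ℝ, prodForm Kbar (fun s => Real.exp (-β s)) xB ν' → ν' = ν) := by
  have ha : ∀ s, 0 < Real.exp (-β s) := fun s => Real.exp_pos _
  have hp : prodForm Kbar (fun s => Real.exp (-β s)) xB ν := fun s => (hpf s).2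
  exact ⟨⟨hxB.2, fun y hy => Lfun_le_of_prodForm ha hxB.2 hp hy⟩,
    fun x' hx' hmin => eq_of_Lfun_le_of_prodForm ha hxB.2 hp hx' (hmin xB hxB.2),
    hp, fun ν' hν' => prodForm_unique hserve ha hp hν'⟩
end
end
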